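/- arXiv:2107.06309 — 3 statements merged into one kernel-verified Lean document; each statement's English description precedes it below -/
import Mathlib

section
/- Let f : {±1}^n → [-1,1] be a function of degree d, and let ℓ ≥ 0. Then the degree-ℓ homogeneous part f_ℓ satisfies ‖f_ℓ‖_∞ ≤ d^ℓ/ℓ!. -/
/-- The sign ±1 corresponding to a boolean: `true ↦ 1`, `false ↦ -1`. -/
noncomputable def sgn (b : Bool) : ℝ := if b then 1 else -1

/-- The character (monomial) `χ_S(x) = ∏_{j ∈ S} x_j` on the cube `{±1}^n`. -/
noncomputable def chi {n : ℕ} (S : Finset (Fin n)) (x : Fin n → Bool) : ℝ :=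
  ∏ i ∈ S, sgn (x i)

/-- The Fourier coefficient `f̂(S) = E[f(X) χ_S(X)]` for `X` uniform on `{±1}^n`. -/
noncomputable def fcoeff {n : ℕ} (f : (Fin n → Bool) → ℝ) (S : Finset (Fin n)) : ℝ :=
  (∑ x : Fin n → Bool, f x * chi S x) / 2 ^ n

/-- The degree-`ℓ` homogeneous part `f_ℓ(x) = ∑_{|S| = ℓ} f̂(S) χ_S(x)`. -/
noncomputable def homPart {n : ℕ} (f : (Fin n → Bool) → ℝ) (ℓ : ℕ) (x : Fin n → Bool) : ℝ :=
  ∑ S ∈ Finset.univ.filter (fun S : Finset (Fin n) => S.card = ℓ), fcoeff f S * chi S x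

/-- `C(d, ℓ)`: the coefficient of `z^ℓ` in the degree-`d` Chebyshev polynomial `T_d`. -/
noncomputable def chebCoeff (d ℓ : ℕ) : ℝ := (Polynomial.Chebyshev.T ℝ (d : ℤ)).coeff ℓ

open Polynomial in
/-- The polynomial `q` collecting the coefficients of `P` whose index has the parity of `ε`,
so that `x ^ ε * q (x ^ 2)` is the even (`ε = 0`) or odd (`ε = 1`) part of `P`. -/
noncomputable def parityPart (ε M : ℕ) (P : ℝ[X]) : ℝ[X] :=
  ∑ k ∈ Finset.range (M + 1), C (P.coeff (2 * k + ε)) * X ^ k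

open Polynomial in
lemma coeff_parityPart {ε M k : ℕ} (P : ℝ[X]) (hk : k ≤ M) :
    (parityPart ε M P).coeff k = P.coeff (2 * k + ε) := by
  rw [parityPart, finsetSum_coeff, Finset.sum_eq_single k]
  · simp
  · intro b _ hb
    simp [coeff_X_pow, hb.symm]
  · intro h
    simp at h
    omega

open Polynomial in
lemma degree_parityPart_lt (ε M : ℕ) (P : ℝ[X]) :
    (parityPart ε M P).degree < (M + 1 : ℕ) := by
  rw [parityPart, ← Fin.sum_univ_eq_sum_range fun k => C (P.coeff (2 * k + ε)) * X ^ k]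
  exact degree_sum_fin_lt _

lemma pow_mul_sum_range_parity {ε : ℕ} (hε : ε < 2) (a : ℕ → ℝ) (t : ℝ) (N : ℕ) :
    t ^ ε * ∑ k ∈ Finset.range N, a (2 * k + ε) * (t ^ 2) ^ k =
      (∑ j ∈ Finset.range (2 * N + ε), a j * t ^ j +
        (-1) ^ ε * ∑ j ∈ Finset.range (2 * N + ε), a j * (-t) ^ j) / 2 := by
  induction N with
  | zero => interval_cases ε <;> simp
  | succ N ih =>
    rw [Finset.sum_range_succ, mul_add, ih,
      show 2 * (N + 1) + ε = 2 * N + ε + 1 + 1 by ring]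
    simp only [Finset.sum_range_succ]
    have hpow : ∀ m, (-t) ^ m = (-1) ^ m * t ^ m := fun m => neg_pow t m
    interval_cases ε
    · simp only [hpow, pow_add, pow_mul]
      norm_num
      ring
    · simp only [hpow, pow_add, pow_mul]
      norm_num
      ring

open Polynomial in
lemma pow_mul_eval_parityPart {ε M : ℕ} (hε : ε < 2) {P : ℝ[X]}
    (hP : P.natDegree < 2 * M + ε + 2) (t : ℝ) :
    t ^ ε * (parityPart ε M P).eval (t ^ 2) = (P.eval t + (-1) ^ ε * P.eval (-t)) / 2 := by
  have hP' : P.natDegree < 2 * (M + 1) + ε := by omega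
  rw [eval_eq_sum_range' hP', eval_eq_sum_range' hP', ← pow_mul_sum_range_parity hε,
    parityPart, eval_finsetSum]
  simp

open Polynomial in
lemma neg_one_pow_mul_coeff_prod_X_sub_C_nonneg {ι : Type*} (s : Finset ι) (v : ι → ℝ)
    (hv : ∀ i ∈ s, 0 ≤ v i) (k : ℕ) :
    0 ≤ (-1) ^ (s.card + k) * (∏ i ∈ s, (X - C (v i))).coeff k := by
  classical
  induction s using Finset.induction_on generalizing k with
  | empty =>
    rcases k with _ | k <;> simp [coeff_one]
  | insert a s ha ih =>
    have ih' := ih fun i hi => hv i (Finset.mem_insert_of_mem hi)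
    have hva := hv a (Finset.mem_insert_self a s)
    rw [Finset.prod_insert ha, Finset.card_insert_of_notMem ha, sub_mul, coeff_sub, coeff_C_mul]
    rcases k with _ | k
    · have h := mul_nonneg hva (ih' 0)
      rw [coeff_X_mul_zero]
      refine h.trans_eq ?_
      ring
    · have h := add_nonneg (ih' k) (mul_nonneg hva (ih' (k + 1)))
      rw [coeff_X_mul]
      refine h.trans_eq ?_
      ring

/-- The differences of a strictly decreasing sequence at index `i` have product of sign
`(-1) ^ i`. -/
lemma neg_one_pow_mul_prod_sub_pos {M : ℕ} {s : ℕ → ℝ}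
    (hs : ∀ i j, i < j → j ≤ M → s j < s i) {i : ℕ} (hi : i ≤ M) :
    0 < (-1) ^ i * ∏ j ∈ (Finset.range (M + 1)).erase i, (s i - s j) := by
  have h₁ : 0 < ∏ j ∈ Finset.range i, ((-1) * (s i - s j)) :=
    Finset.prod_pos fun j hj => by
      linarith [hs j i (Finset.mem_range.mp hj) hi]
  rw [Finset.prod_mul_distrib, Finset.prod_const, Finset.card_range] at h₁
  have h₂ : 0 < ∏ j ∈ Finset.Ioc i M, (s i - s j) :=
    Finset.prod_pos fun j hj => sub_pos.mpr <|
      hs i j (Finset.mem_Ioc.mp hj).1 (Finset.mem_Ioc.mp hj).2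
  have union : (Finset.range (M + 1)).erase i = Finset.range i ∪ Finset.Ioc i M := by grind
  have disjoint : Disjoint (Finset.range i) (Finset.Ioc i M) := by grind [Finset.disjoint_iff_ne]
  rw [union, Finset.prod_union disjoint, ← mul_assoc]
  exact mul_pos h₁ h₂

open Polynomial in
lemma neg_one_pow_mul_coeff_basis_nonneg {M : ℕ} {s : ℕ → ℝ}
    (hs : ∀ i j, i < j → j ≤ M → s j < s i) (hs0 : ∀ i ≤ M, 0 ≤ s i) {i : ℕ} (hi : i ≤ M)
    (k : ℕ) :
    0 ≤ (-1) ^ (M + k) * ((-1) ^ i * (Lagrange.basis (Finset.range (M + 1)) s i).coeff k) := by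
  have h1 := (neg_one_pow_mul_prod_sub_pos hs hi).le
  have h2 := neg_one_pow_mul_coeff_prod_X_sub_C_nonneg ((Finset.range (M + 1)).erase i) s
    (fun j hj => hs0 j (by simp at hj; omega)) k
  have hcard : ((Finset.range (M + 1)).erase i).card = M := by
    rw [Finset.card_erase_of_mem (by simp; omega)]; simp
  rw [hcard] at h2
  have h3 := mul_nonneg (inv_nonneg.mpr h1) h2
  have hinv : ((-1 : ℝ) ^ i)⁻¹ = (-1) ^ i := by
    rw [← inv_pow]; norm_num
  simp only [Lagrange.basis, Lagrange.basisDivisor, Finset.prod_mul_distrib]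
  rw [← map_prod, coeff_C_mul, Finset.prod_inv_distrib]
  refine h3.trans_eq ?_
  rw [mul_inv, hinv]
  ring

open Polynomial in
lemma coeff_eq_sum_eval_mul_coeff_basis {M : ℕ} {s : ℕ → ℝ}
    (hs : ∀ i j, i < j → j ≤ M → s j < s i) {Q : ℝ[X]} (hQ : Q.degree < (M + 1 : ℕ)) (k : ℕ) :
    Q.coeff k = ∑ i ∈ Finset.range (M + 1),
      Q.eval (s i) * (Lagrange.basis (Finset.range (M + 1)) s i).coeff k := by
  have hinj : Set.InjOn s (Finset.range (M + 1)) := by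
    intro i hi j hj hij
    simp only [Finset.coe_range, Set.mem_Iio] at hi hj
    rcases lt_trichotomy i j with h | h | h
    · exact absurd hij (hs i j h (by omega)).ne'
    · exact h
    · exact absurd hij (hs j i h (by omega)).ne
  conv_lhs => rw [Lagrange.eq_interpolate hinj (f := Q) (by simpa using hQ)]
  rw [Lagrange.interpolate_apply, finsetSum_coeff]
  simp [coeff_C_mul]

open Polynomial Chebyshev in
/-- Half of the extremal points of `T_{2M+ε}` are nonnegative. -/
lemma node_nonneg {ε M i : ℕ} (hi : i ≤ M) (h : ε ≠ 0 ∨ M ≠ 0) :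
    0 ≤ node (2 * M + ε) i := by
  have hpos : (0 : ℝ) < (2 * M + ε : ℕ) := by
    exact_mod_cast (by omega : 0 < 2 * M + ε)
  refine Real.cos_nonneg_of_neg_pi_div_two_le_of_le ?_ ?_
  · have : 0 ≤ (i : ℝ) * Real.pi / (2 * M + ε : ℕ) := by positivity
    linarith [Real.pi_pos]
  · rw [div_le_div_iff₀ hpos two_pos]
    have hiM : (2 * i : ℝ) ≤ (2 * M + ε : ℕ) := by
      exact_mod_cast (by omega : 2 * i ≤ 2 * M + ε)
    nlinarith [Real.pi_pos]

open Polynomial Chebyshev in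
lemma node_pos {ε M i : ℕ} (hε : ε ≠ 0) (hi : i ≤ M) : 0 < node (2 * M + ε) i := by
  have hpos : (0 : ℝ) < (2 * M + ε : ℕ) := by
    exact_mod_cast (by omega : 0 < 2 * M + ε)
  refine Real.cos_pos_of_mem_Ioo ⟨?_, ?_⟩
  · have : 0 ≤ (i : ℝ) * Real.pi / (2 * M + ε : ℕ) := by positivity
    linarith [Real.pi_pos]
  · rw [div_lt_div_iff₀ hpos two_pos]
    have hiM : (2 * i : ℝ) < (2 * M + ε : ℕ) := by
      exact_mod_cast (by omega : 2 * i < 2 * M + ε)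
    nlinarith [Real.pi_pos]

open Polynomial Chebyshev in
/-- V. Markov: among polynomials of degree at most `2M + ε + 1` bounded by `1` on `[-1, 1]`, the
Chebyshev polynomial `T_{2M+ε}` has the largest coefficients at indices of the parity of `ε`. -/
theorem abs_coeff_le_abs_coeff_T {ε M k : ℕ} (hε : ε < 2) (hk : k ≤ M) {P : ℝ[X]}
    (hdeg : P.natDegree < 2 * M + ε + 2) (hP : ∀ t ∈ Set.Icc (-1 : ℝ) 1, |P.eval t| ≤ 1) :
    |P.coeff (2 * k + ε)| ≤ |(T ℝ ((2 * M + ε : ℕ) : ℤ)).coeff (2 * k + ε)| := by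
  set m := 2 * M + ε with hm
  set x : ℕ → ℝ := fun i => node m i with hx
  set s : ℕ → ℝ := fun i => x i ^ 2 with hs_sq
  have hx0 : ∀ i ≤ M, 0 ≤ x i := by
    intro i hi
    by_cases h : ε ≠ 0 ∨ M ≠ 0
    · exact node_nonneg hi h
    · have : i = 0 := by omega
      simp [hx, this, node_eq_one]
  have hxε : ∀ i ≤ M, 0 < x i ^ ε := by
    intro i hi
    rcases eq_or_ne ε 0 with h | h
    · simp [h]
    · exact pow_pos (node_pos h hi) ε
  have hs : ∀ i j, i < j → j ≤ M → s j < s i := by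
    intro i j hij hj
    exact pow_lt_pow_left₀ (node_lt (by omega) hij) (hx0 j hj) two_ne_zero
  have hTdeg : (T ℝ (m : ℤ)).natDegree < 2 * M + ε + 2 := by
    rw [natDegree_T]; simp; omega
  have hTx : ∀ i ≤ M, x i ^ ε * (parityPart ε M (T ℝ (m : ℤ))).eval (s i) = (-1) ^ i := by
    intro i hi
    have hsq : ((-1 : ℝ) ^ ε) * (-1) ^ ε = 1 := by rw [← mul_pow]; norm_num
    have hneg : (((m : ℤ).negOnePow : ℤ) : ℝ) = (-1) ^ ε := by
      rw [Int.cast_negOnePow_natCast, hm, pow_add, pow_mul]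
      norm_num
    rw [pow_mul_eval_parityPart hε hTdeg, T_eval_neg, hneg, ← mul_assoc, hsq,
      eval_T_real_node (by simp; omega)]
    ring
  have hPx : ∀ i, |x i ^ ε * (parityPart ε M P).eval (s i)| ≤ 1 := by
    intro i
    have hmem := node_mem_Icc (n := m) (i := i)
    have h1 := hP (x i) hmem
    have h2 := hP (-x i) ⟨by linarith [hmem.2], by linarith [hmem.1]⟩
    rw [pow_mul_eval_parityPart hε hdeg, abs_div, abs_two, div_le_one two_pos]
    refine (abs_add_le _ _).trans ?_
    rw [abs_mul, abs_neg_one_pow, one_mul]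
    linarith
  rw [← coeff_parityPart P hk, ← coeff_parityPart (T ℝ (m : ℤ)) hk,
    coeff_eq_sum_eval_mul_coeff_basis hs (degree_parityPart_lt ε M P),
    coeff_eq_sum_eval_mul_coeff_basis hs (degree_parityPart_lt ε M (T ℝ (m : ℤ)))]
  set b : ℕ → ℝ := fun i => (Lagrange.basis (Finset.range (M + 1)) s i).coeff k
  calc _ ≤ ∑ i ∈ Finset.range (M + 1), |(parityPart ε M P).eval (s i) * b i| :=
        Finset.abs_sum_le_sum_abs _ _
    _ ≤ ∑ i ∈ Finset.range (M + 1),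
          (-1) ^ (M + k) * ((parityPart ε M (T ℝ (m : ℤ))).eval (s i) * b i) := by
        refine Finset.sum_le_sum fun i hi => ?_
        have hi : i ≤ M := by simp at hi; omega
        have hsign := neg_one_pow_mul_coeff_basis_nonneg hs (fun i _ => sq_nonneg _) hi k
        have habs : |b i| = (-1) ^ (M + k) * ((-1) ^ i * b i) := by
          rw [← abs_of_nonneg hsign, abs_mul, abs_mul, abs_neg_one_pow, abs_neg_one_pow]
          simp [b]
        rw [← mul_le_mul_iff_right₀ (hxε i hi)]
        calc _ = |x i ^ ε * (parityPart ε M P).eval (s i)| * |b i| := by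
              rw [abs_mul, abs_mul, abs_of_pos (hxε i hi), mul_assoc]
          _ ≤ 1 * |b i| := by gcongr; exact hPx i
          _ = _ := by rw [habs, ← hTx i hi]; ring
    _ = (-1) ^ (M + k) * ∑ i ∈ Finset.range (M + 1),
          (parityPart ε M (T ℝ (m : ℤ))).eval (s i) * b i := by rw [Finset.mul_sum]
    _ ≤ _ := by
        refine (le_abs_self _).trans_eq ?_
        rw [abs_mul, abs_neg_one_pow, one_mul]

open Polynomial Chebyshev in
lemma abs_eval_zero_iterate_derivative_T_le (m k : ℕ) :
    |(derivative^[k] (T ℝ (m : ℤ))).eval 0| ≤ (m : ℝ) ^ k := by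
  induction k using Nat.twoStepInduction with
  | zero => simpa using abs_eval_T_real_le_one (m : ℤ) (x := 0) (by simp)
  | one =>
    have hU : |(U ℝ ((m : ℤ) - 1)).eval 0| ≤ 1 := by
      rw [U_eval_zero]
      split_ifs
      · rcases Int.units_eq_one_or (((m : ℤ) - 1) / 2).negOnePow with h | h <;> simp [h]
      · simp
    rw [Function.iterate_one, T_derivative_eq_U]
    simpa [abs_mul] using mul_le_mul_of_nonneg_left hU m.cast_nonneg
  | more k ih _ =>
    rcases le_or_gt k m with hkm | hkm
    · rw [iterate_derivative_T_eval_zero_recurrence, abs_mul, pow_add, mul_comm]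
      have hk : (k : ℝ) ≤ m := by exact_mod_cast hkm
      gcongr
      rw [abs_le]
      push_cast
      constructor <;> nlinarith [sq_nonneg (k : ℝ), sq_nonneg (m : ℝ)]
    · rw [iterate_derivative_eq_zero (by rw [natDegree_T]; simp; omega)]
      simp

open Polynomial Chebyshev in
lemma abs_coeff_T_le (m k : ℕ) :
    |(T ℝ (m : ℤ)).coeff k| ≤ (m : ℝ) ^ k / k.factorial := by
  have h := abs_eval_zero_iterate_derivative_T_le m k
  rw [← coeff_zero_eq_eval_zero, coeff_iterate_derivative, zero_add, Nat.descFactorial_self,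
    nsmul_eq_mul, abs_mul, Nat.abs_cast] at h
  rw [le_div_iff₀ (by positivity), mul_comm]
  exact h

open Polynomial in
theorem abs_coeff_le_pow_div_factorial {d : ℕ} {P : ℝ[X]} (hdeg : P.natDegree ≤ d)
    (hP : ∀ t ∈ Set.Icc (-1 : ℝ) 1, |P.eval t| ≤ 1) (l : ℕ) :
    |P.coeff l| ≤ (d : ℝ) ^ l / l.factorial := by
  rcases lt_or_ge d l with h | h
  · rw [coeff_eq_zero_of_natDegree_lt (by omega), abs_zero]
    positivity
  have hl : l = 2 * (l / 2) + l % 2 := by omega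
  have hmain := abs_coeff_le_abs_coeff_T (ε := l % 2) (M := (d - l % 2) / 2) (k := l / 2)
    (by omega) (by omega) (by omega) hP
  rw [← hl] at hmain
  refine hmain.trans ((abs_coeff_T_le _ _).trans ?_)
  gcongr
  omega

/-- The density of the noise kernel: `y_i = x_i` with probability `(1 + t) / 2`. -/
noncomputable def noiseKernel {n : ℕ} (t : ℝ) (x y : Fin n → Bool) : ℝ :=
  ∏ i, (1 + t * sgn (x i) * sgn (y i)) / 2

lemma abs_sgn (b : Bool) : |sgn b| = 1 := by cases b <;> simp [sgn]

lemma noiseKernel_nonneg {n : ℕ} {t : ℝ} (ht : t ∈ Set.Icc (-1 : ℝ) 1) (x y : Fin n → Bool) :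
    0 ≤ noiseKernel t x y := by
  refine Finset.prod_nonneg fun i _ => ?_
  have h : |t * sgn (x i) * sgn (y i)| ≤ 1 := by
    rw [abs_mul, abs_mul, abs_sgn, abs_sgn, mul_one, mul_one]
    exact abs_le.mpr ht
  linarith [(abs_le.mp h).1]

lemma sum_noiseKernel {n : ℕ} (t : ℝ) (x : Fin n → Bool) :
    ∑ y, noiseKernel t x y = 1 := by
  simp only [noiseKernel]
  rw [← Fintype.prod_sum fun i (b : Bool) => (1 + t * sgn (x i) * sgn b) / 2]
  refine Finset.prod_eq_one fun i _ => ?_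
  simp [sgn]
  ring

lemma noiseKernel_eq_sum {n : ℕ} (t : ℝ) (x y : Fin n → Bool) :
    noiseKernel t x y =
      (∑ S : Finset (Fin n), t ^ S.card * chi S x * chi S y) / 2 ^ n := by
  simp only [noiseKernel, Finset.prod_div_distrib, Finset.prod_one_add, Finset.powerset_univ, chi,
    Finset.prod_mul_distrib]
  simp

lemma sum_mul_noiseKernel {n : ℕ} (f : (Fin n → Bool) → ℝ) (t : ℝ) (x : Fin n → Bool) :
    ∑ y, f y * noiseKernel t x y =
      ∑ S : Finset (Fin n), fcoeff f S * chi S x * t ^ S.card := by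
  simp only [noiseKernel_eq_sum, fcoeff, Finset.sum_div, Finset.sum_mul, Finset.mul_sum]
  rw [Finset.sum_comm]
  refine Finset.sum_congr rfl fun S _ => Finset.sum_congr rfl fun y _ => ?_
  ring

lemma abs_sum_mul_noiseKernel_le {n : ℕ} {f : (Fin n → Bool) → ℝ} (hf : ∀ y, |f y| ≤ 1)
    {t : ℝ} (ht : t ∈ Set.Icc (-1 : ℝ) 1) (x : Fin n → Bool) :
    |∑ y, f y * noiseKernel t x y| ≤ 1 := by
  refine (Finset.abs_sum_le_sum_abs _ _).trans ?_
  rw [← sum_noiseKernel t x]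
  refine Finset.sum_le_sum fun y _ => ?_
  rw [abs_mul, abs_of_nonneg (noiseKernel_nonneg ht x y)]
  exact mul_le_of_le_one_left (noiseKernel_nonneg ht x y) (hf y)

open Polynomial in
/-- The polynomial `∑_ℓ f_ℓ(x) t^ℓ` in `t`. -/
noncomputable def noisePoly {n : ℕ} (f : (Fin n → Bool) → ℝ) (x : Fin n → Bool) : ℝ[X] :=
  ∑ S : Finset (Fin n), monomial S.card (fcoeff f S * chi S x)

lemma eval_noisePoly {n : ℕ} (f : (Fin n → Bool) → ℝ) (x : Fin n → Bool) (t : ℝ) :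
    (noisePoly f x).eval t = ∑ y, f y * noiseKernel t x y := by
  rw [sum_mul_noiseKernel, noisePoly, Polynomial.eval_finsetSum]
  simp

lemma coeff_noisePoly {n : ℕ} (f : (Fin n → Bool) → ℝ) (x : Fin n → Bool) (l : ℕ) :
    (noisePoly f x).coeff l = homPart f l x := by
  rw [noisePoly, Polynomial.finsetSum_coeff, homPart, Finset.sum_filter]
  simp [Polynomial.coeff_monomial]

lemma natDegree_noisePoly_le {n d : ℕ} {f : (Fin n → Bool) → ℝ}
    (hdeg : ∀ S : Finset (Fin n), d < S.card → fcoeff f S = 0) (x : Fin n → Bool) :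
    (noisePoly f x).natDegree ≤ d := by
  refine Polynomial.natDegree_sum_le_of_forall_le _ _ fun S _ => ?_
  rcases le_or_gt S.card d with h | h
  · exact (Polynomial.natDegree_monomial_le _).trans h
  · simp [hdeg S h]

/-- If `f : {±1}^n → [-1,1]` has degree `d`, then `‖f_ℓ‖_∞ ≤ d^ℓ / ℓ!`. -/
theorem stmt1 (n d ℓ : ℕ) (f : (Fin n → Bool) → ℝ)
    (hbdd : ∀ x, |f x| ≤ 1)
    (hdeg : ∀ S : Finset (Fin n), d < S.card → fcoeff f S = 0) :
    ∀ x : Fin n → Bool, |homPart f ℓ x| ≤ (d : ℝ) ^ ℓ / (Nat.factorial ℓ) := by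
  intro x
  rw [← coeff_noisePoly]
  refine abs_coeff_le_pow_div_factorial (natDegree_noisePoly_le hdeg x) (fun t ht => ?_) ℓ
  rw [eval_noisePoly]
  exact abs_sum_mul_noiseKernel_le hbdd ht x
end

section
/- Let ℓ, m, n be positive integers, let ‖·‖ be any norm on ℝ^m, and let X be uniformly distributed on {±1}^n. Then for every function f : {±1}^n → ℝ^m, E[‖f_ℓ(X)‖²]^{1/2} ≤ (4 + 6·log(m+1)/ℓ)^ℓ · E[‖f(X)‖²]^{1/2}. -/
/-- Vector-valued Fourier coefficient `f̂(S) ∈ ℝ^m`. -/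
noncomputable def fcoeffV {n m : ℕ} (f : (Fin n → Bool) → (Fin m → ℝ))
    (S : Finset (Fin n)) : Fin m → ℝ :=
  fun i => (∑ x : Fin n → Bool, f x i * chi S x) / 2 ^ n

/-- Degree-`ℓ` homogeneous part of a vector-valued function on the cube. -/
noncomputable def homPartV {n m : ℕ} (f : (Fin n → Bool) → (Fin m → ℝ)) (ℓ : ℕ)
    (x : Fin n → Bool) : Fin m → ℝ :=
  fun i => ∑ S ∈ Finset.univ.filter (fun S : Finset (Fin n) => S.card = ℓ),
    fcoeffV f S i * chi S x

lemma Complex.arctan_re_mem {z : ℂ} (hz : ‖z‖ < 1) (hre : 0 ≤ z.re) :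
    0 ≤ (arctan z).re ∧ (arctan z).re ≤ z.re / (1 - ‖z‖ ^ 2) := by
  set Q : ℂ := (1 + z * I) / (1 - z * I) with hQ
  have h1 : (arctan z).re = arg Q / 2 := by
    simp [arctan, ← hQ, Complex.mul_re, Complex.log_im]
    ring
  have hn : ‖z‖ ^ 2 = z.re ^ 2 + z.im ^ 2 := by
    rw [Complex.sq_norm, Complex.normSq_apply]; ring
  have hlt : z.re ^ 2 + z.im ^ 2 < 1 := by
    rw [← hn]; nlinarith [norm_nonneg z]
  have hD : 0 < normSq (1 - z * I) := by
    rw [Complex.normSq_apply]; simp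
    nlinarith [sq_nonneg (1 + z.im), sq_nonneg z.re, sq_nonneg (z.im)]
  have hQre : Q.re = (1 - ‖z‖ ^ 2) / normSq (1 - z * I) := by
    rw [hQ, Complex.div_re, hn]; simp; field_simp; ring
  have hQim : Q.im = 2 * z.re / normSq (1 - z * I) := by
    rw [hQ, Complex.div_im]; simp; field_simp; ring
  have hp : 0 < 1 - ‖z‖ ^ 2 := by rw [hn]; linarith
  have hQpos : 0 < Q.re := by rw [hQre]; positivity
  have harg0 : 0 ≤ arg Q := by rw [Complex.arg_nonneg_iff, hQim]; positivity
  have harg1 : arg Q < Real.pi / 2 := by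
    have := (Complex.abs_arg_lt_pi_div_two_iff (z := Q)).2 (Or.inl hQpos)
    exact (abs_lt.1 this).2
  have hle := Real.le_tan harg0 harg1
  rw [Complex.tan_arg, hQim, hQre] at hle
  rw [h1]
  refine ⟨by positivity, ?_⟩
  have : 2 * z.re / normSq (1 - z * I) / ((1 - ‖z‖ ^ 2) / normSq (1 - z * I)) =
      2 * (z.re / (1 - ‖z‖ ^ 2)) := by field_simp
  linarith

lemma Complex.norm_tan_le_one {w : ℂ} (h0 : 0 ≤ w.re) (h1 : w.re ≤ Real.pi / 4) : ‖tan w‖ ≤ 1 := by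
  have hs : ‖sin w‖ ^ 2 = Real.sin w.re ^ 2 * Real.cosh w.im ^ 2
      + Real.cos w.re ^ 2 * Real.sinh w.im ^ 2 := by
    rw [Complex.sq_norm, Complex.normSq_apply, Complex.sin_eq]
    simp only [add_re, add_im, mul_re, mul_im, sin_ofReal_re, sin_ofReal_im, cos_ofReal_re,
      cos_ofReal_im, sinh_ofReal_re, sinh_ofReal_im, cosh_ofReal_re, cosh_ofReal_im, I_re, I_im]
    ring
  have hc : ‖cos w‖ ^ 2 = Real.cos w.re ^ 2 * Real.cosh w.im ^ 2
      + Real.sin w.re ^ 2 * Real.sinh w.im ^ 2 := by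
    rw [Complex.sq_norm, Complex.normSq_apply, Complex.cos_eq]
    simp only [sub_re, sub_im, mul_re, mul_im, sin_ofReal_re, sin_ofReal_im, cos_ofReal_re,
      cos_ofReal_im, sinh_ofReal_re, sinh_ofReal_im, cosh_ofReal_re, cosh_ofReal_im, I_re, I_im]
    ring
  have h2 : Real.sin w.re ≤ Real.cos w.re := by
    rw [← Real.cos_pi_div_two_sub]
    exact Real.cos_le_cos_of_nonneg_of_le_pi h0 (by linarith [Real.pi_pos]) (by linarith)
  have h3 : 0 ≤ Real.sin w.re := Real.sin_nonneg_of_nonneg_of_le_pi h0 (by linarith [Real.pi_pos])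
  have h4 := Real.cosh_sq w.im
  have : ‖sin w‖ ≤ ‖cos w‖ := by
    refine le_of_sq_le_sq ?_ (norm_nonneg _)
    rw [hs, hc, h4]; nlinarith
  rw [tan, norm_div]
  exact div_le_one_of_le₀ this (norm_nonneg _)

open Complex HadamardThreeLines in
lemma Polynomial.norm_eval_le_of_im_nonneg (P : Polynomial ℂ) {A M : ℝ} (hA : 0 < A) (hM : 1 ≤ M)
    (hreal : ∀ x : ℝ, |x| ≤ 1 → ‖P.eval (x : ℂ)‖ ≤ A)
    (hdisc : ∀ z : ℂ, ‖z‖ ≤ 1 → ‖P.eval z‖ ≤ A * M) {z : ℂ} (hz : ‖z‖ ≤ 1 / 2) (him : 0 ≤ z.im) :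
    ‖P.eval z‖ ≤ A * M ^ (16 / (3 * Real.pi) * ‖z‖) := by
  have hpi := Real.pi_pos
  have hpi3 := Real.pi_gt_three
  set ζ : ℂ := -I * z with hζ
  have hζn : ‖ζ‖ = ‖z‖ := by simp [hζ]
  have hζre : ζ.re = z.im := by simp [hζ]
  obtain ⟨h0, h1⟩ := Complex.arctan_re_mem (z := ζ) (by rw [hζn]; linarith) (by rw [hζre]; exact him)
  set w := arctan ζ with hw
  have htan : tan w = ζ := by
    apply Complex.tan_arctan <;> intro h <;> rw [h] at hζn <;> simp at hζn <;> linarith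
  have hre : w.re ≤ 4 / 3 * ‖z‖ := by
    refine h1.trans ?_
    rw [hζn, hζre, div_le_iff₀ (by nlinarith [norm_nonneg z])]
    have h2 := (abs_le.1 (Complex.abs_im_le_norm z)).2
    have h3 : (3:ℝ) / 4 ≤ 1 - ‖z‖ ^ 2 := by nlinarith [norm_nonneg z]
    nlinarith [norm_nonneg z]
  have hwle : w.re ≤ Real.pi / 4 := by linarith
  have hcos : ∀ s : ℂ, s ∈ verticalClosedStrip 0 (Real.pi / 4) → cos s ≠ 0 := by
    intro s hs
    have hs1 : 0 ≤ s.re := hs.1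
    have hs2 : s.re ≤ Real.pi / 4 := hs.2
    refine Complex.cos_ne_zero_of_arctan_bounds ?_ (by linarith) (by linarith)
    intro h
    rw [h] at hs2
    norm_num at hs2
    linarith
  have hbd : ∀ s : ℂ, s ∈ verticalClosedStrip 0 (Real.pi / 4) → ‖P.eval (I * tan s)‖ ≤ A * M := by
    intro s hs
    apply hdisc
    simpa using Complex.norm_tan_le_one hs.1 hs.2
  have key := norm_le_interp_of_mem_verticalClosedStrip' (f := fun s => P.eval (I * tan s)) (z := w)
    (a := A) (b := A * M) (l := 0) (u := Real.pi / 4) (by positivity) ⟨h0, hwle⟩ ?_ ?_ ?_ ?_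
  · have e : P.eval z = P.eval (I * tan w) := by
      rw [htan, hζ, ← mul_assoc]; simp
    rw [e]
    refine key.trans ?_
    set t := (w.re - 0) / (Real.pi / 4 - 0) with ht
    rw [Real.mul_rpow hA.le (by linarith), ← mul_assoc, ← Real.rpow_add hA]
    simp only [sub_add_cancel, Real.rpow_one]
    refine mul_le_mul_of_nonneg_left (Real.rpow_le_rpow_of_exponent_le hM ?_) hA.le
    rw [ht, sub_zero, sub_zero, div_le_iff₀ (by positivity)]
    refine hre.trans (le_of_eq ?_)
    field_simp
    ring
  · have hd : DifferentiableOn ℂ (fun s => P.eval (I * tan s))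
        (verticalClosedStrip 0 (Real.pi / 4)) := by
      intro s hs
      refine DifferentiableAt.differentiableWithinAt ?_
      have := Complex.differentiableAt_tan.2 (hcos s hs)
      exact (P.differentiable _).comp s ((differentiableAt_const _).mul this)
    refine ⟨hd.mono fun s hs => ⟨hs.1.le, hs.2.le⟩, hd.continuousOn.mono ?_⟩
    refine closure_minimal (fun s hs => ⟨hs.1.le, hs.2.le⟩) ?_
    exact isClosed_Icc.preimage Complex.continuous_re
  · refine ⟨A * M, ?_⟩
    rintro _ ⟨s, hs, rfl⟩
    exact hbd s hs
  · intro s hs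
    have hs' : s = (s.im : ℂ) * I := by
      apply Complex.ext <;> simp
      exact hs
    have : I * tan s = ((-Real.tanh s.im : ℝ) : ℂ) := by
      rw [hs', Complex.tan_mul_I]
      simp [mul_comm]
      rw [← mul_assoc]; simp
    simp only [this]
    apply hreal
    rw [abs_neg]
    exact (Real.abs_tanh_lt_one _).le
  · intro s hs
    have hs' : s.re = Real.pi / 4 := hs
    exact hbd s ⟨by rw [hs']; positivity, hs'.le⟩

lemma Polynomial.norm_eval_le_of_norm_le_half (P : Polynomial ℂ) {A M : ℝ} (hA : 0 < A) (hM : 1 ≤ M)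
    (hreal : ∀ x : ℝ, |x| ≤ 1 → ‖P.eval (x : ℂ)‖ ≤ A)
    (hdisc : ∀ z : ℂ, ‖z‖ ≤ 1 → ‖P.eval z‖ ≤ A * M) {z : ℂ} (hz : ‖z‖ ≤ 1 / 2) :
    ‖P.eval z‖ ≤ A * M ^ (16 / (3 * Real.pi) * ‖z‖) := by
  rcases le_total 0 z.im with h | h
  · exact P.norm_eval_le_of_im_nonneg hA hM hreal hdisc hz h
  · have := (P.comp (-Polynomial.X)).norm_eval_le_of_im_nonneg (z := -z) hA hM
      (fun x hx => by simpa using hreal (-x) (by simpa using hx))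
      (fun z hz => by simpa using hdisc (-z) (by simpa using hz)) (by simpa using hz) (by simpa using h)
    simpa using this

lemma Polynomial.norm_coeff_mul_pow_le (P : Polynomial ℂ) {r C : ℝ} (hr : 0 < r)
    (h : ∀ z : ℂ, ‖z‖ = r → ‖P.eval z‖ ≤ C) (k : ℕ) : ‖P.coeff k‖ * r ^ k ≤ C := by
  have h1 := Complex.norm_iteratedDeriv_le_of_forall_mem_sphere_norm_le (c := 0) k hr
    (f := fun z => P.eval z) P.differentiable.diffContOnCl (C := C) (fun z hz => h z (by simpa using hz))
  have h2 : iteratedDeriv k (fun z => P.eval z) 0 = k.factorial * P.coeff k := by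
    have : ∀ (k : ℕ) (P : Polynomial ℂ), iteratedDeriv k (fun z => P.eval z) =
        fun z => (Polynomial.derivative^[k] P).eval z := by
      intro k
      induction k with
      | zero => intro P; simp
      | succ k ih =>
        intro P
        rw [iteratedDeriv_succ', Function.iterate_succ_apply, ← ih]
        congr 1
        ext z
        simp
    rw [this]
    simp only
    rw [← Polynomial.coeff_zero_eq_eval_zero, Polynomial.coeff_iterate_derivative]
    simp [Nat.descFactorial_self]
  have hk : (0:ℝ) < k.factorial := by positivity
  rw [h2, norm_mul, Complex.norm_natCast, le_div_iff₀ (by positivity), mul_assoc, mul_le_mul_iff_right₀ hk] at h1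
  exact h1

lemma Polynomial.norm_coeff_le (P : Polynomial ℂ) {A M : ℝ} (hA : 0 < A) (hM : 1 ≤ M)
    (hreal : ∀ x : ℝ, |x| ≤ 1 → ‖P.eval (x : ℂ)‖ ≤ A)
    (hdisc : ∀ z : ℂ, ‖z‖ ≤ 1 → ‖P.eval z‖ ≤ A * M) {ℓ : ℕ} (hℓ : 0 < ℓ) :
    ‖P.coeff ℓ‖ ≤ (4 + 6 * Real.log M / ℓ) ^ ℓ * A := by
  have hℓ' : (0:ℝ) < ℓ := by exact_mod_cast hℓ
  have hL : 0 ≤ Real.log M := Real.log_nonneg hM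
  have hpi3 := Real.pi_gt_three
  set q : ℝ := 2 + 3 * (Real.log M / ℓ) with hq
  have hq2 : 2 ≤ q := by
    have : 0 ≤ Real.log M / ℓ := by positivity
    linarith
  have hexp : M ^ (16 / (3 * Real.pi) * (1 / q)) ≤ 2 ^ ℓ := by
    rw [Real.rpow_def_of_pos (by linarith)]
    have : (2:ℝ) ^ ℓ = Real.exp (Real.log 2 * ℓ) := by
      rw [mul_comm, Real.exp_nat_mul, Real.exp_log (by norm_num)]
    rw [this, Real.exp_le_exp]
    have h1 : Real.log M * (1 / q) ≤ ℓ / 3 := by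
      rw [mul_one_div, div_le_iff₀ (by linarith), hq]
      have : (ℓ:ℝ) / 3 * (2 + 3 * (Real.log M / ℓ)) = 2 * ℓ / 3 + Real.log M := by field_simp
      rw [this]; linarith
    have h2 : 16 / (3 * Real.pi) ≤ 16 / 9 := by
      apply div_le_div_of_nonneg_left <;> linarith
    have h3 := Real.log_two_gt_d9
    calc Real.log M * (16 / (3 * Real.pi) * (1 / q))
        = 16 / (3 * Real.pi) * (Real.log M * (1 / q)) := by ring
      _ ≤ 16 / 9 * (ℓ / 3) := by gcongr
      _ ≤ Real.log 2 * ℓ := by nlinarith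
  have h := P.norm_coeff_mul_pow_le (r := 1 / q) (C := A * 2 ^ ℓ) (by positivity) (fun z hz => by
    refine (P.norm_eval_le_of_norm_le_half hA hM hreal hdisc ?_).trans ?_
    · rw [hz]; exact one_div_le_one_div_of_le (by norm_num) hq2
    · rw [hz]; gcongr) ℓ
  have hqp : 0 < q := by linarith
  rw [div_pow, one_pow, mul_one_div, div_le_iff₀ (by positivity)] at h
  refine h.trans (le_of_eq ?_)
  have : 4 + 6 * Real.log M / ℓ = 2 * q := by rw [hq]; ring
  rw [this, mul_pow]; ring

lemma sgn_mul_self (b : Bool) : sgn b * sgn b = 1 := by cases b <;> simp [sgn]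

lemma sum_pow_card_mul_chi_mul_chi {n : ℕ} (ρ : ℝ) (x y : Fin n → Bool) :
    ∑ S : Finset (Fin n), ρ ^ S.card * (chi S x * chi S y) =
      ∏ i, (1 + ρ * (sgn (x i) * sgn (y i))) := by
  rw [Finset.prod_one_add, Finset.powerset_univ]
  refine Finset.sum_congr rfl fun S _ => ?_
  simp [chi, Finset.prod_mul_distrib]

lemma sum_chi_mul_chi {n : ℕ} (x y : Fin n → Bool) :
    ∑ S : Finset (Fin n), chi S x * chi S y = if x = y then 2 ^ n else 0 := by
  have h := sum_pow_card_mul_chi_mul_chi 1 x y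
  simp only [one_pow, one_mul] at h
  rw [h]
  split_ifs with hxy
  · subst hxy
    simp [sgn_mul_self]
    norm_num
  · obtain ⟨i, hi⟩ := Function.ne_iff.1 hxy
    refine Finset.prod_eq_zero (Finset.mem_univ i) ?_
    revert hi
    cases x i <;> cases y i <;> simp [sgn]

lemma sum_prod_one_add_sgn {n : ℕ} (ρ : ℝ) (x : Fin n → Bool) :
    ∑ y : Fin n → Bool, ∏ i, (1 + ρ * (sgn (x i) * sgn (y i))) = 2 ^ n := by
  have := Finset.prod_univ_sum (fun _ : Fin n => (Finset.univ : Finset Bool))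
    (fun i b => 1 + ρ * (sgn (x i) * sgn b))
  rw [Fintype.piFinset_univ] at this
  rw [← this]
  have h : ∀ i, ∑ b : Bool, (1 + ρ * (sgn (x i) * sgn b)) = 2 := by
    intro i
    simp [sgn]
    ring
  simp only [h, Finset.prod_const, Finset.card_univ, Fintype.card_fin]

lemma sum_sq_sum_mul_chi {n : ℕ} (h : (Fin n → Bool) → ℝ) :
    ∑ S : Finset (Fin n), (∑ x, h x * chi S x) ^ 2 = 2 ^ n * ∑ x, h x ^ 2 := by
  have h1 : ∀ S : Finset (Fin n), (∑ x, h x * chi S x) ^ 2 =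
      ∑ x, ∑ y, h x * h y * (chi S x * chi S y) := by
    intro S
    rw [sq, Finset.sum_mul_sum]
    refine Finset.sum_congr rfl fun x _ => Finset.sum_congr rfl fun y _ => by ring
  simp only [h1]
  rw [Finset.sum_comm, Finset.mul_sum]
  refine Finset.sum_congr rfl fun x _ => ?_
  rw [Finset.sum_comm]
  simp only [← Finset.mul_sum, sum_chi_mul_chi]
  simp
  ring

section
variable {E : Type*} [NormedAddCommGroup E] [NormedSpace ℝ E] {n : ℕ}

/-- The Fourier coefficient of a function on the cube with values in a real vector space. -/
noncomputable def vhat (f : (Fin n → Bool) → E) (S : Finset (Fin n)) : E :=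
  (2 ^ n : ℝ)⁻¹ • ∑ y, chi S y • f y

lemma sum_norm_sq_noise_le (f : (Fin n → Bool) → E) {ρ : ℝ} (hρ : |ρ| ≤ 1) :
    ∑ x, ‖∑ S : Finset (Fin n), ρ ^ S.card • chi S x • vhat f S‖ ^ 2 ≤ ∑ x, ‖f x‖ ^ 2 := by
  set K : (Fin n → Bool) → (Fin n → Bool) → ℝ :=
    fun x y => (2 ^ n : ℝ)⁻¹ * ∏ i, (1 + ρ * (sgn (x i) * sgn (y i))) with hK
  have hK0 : ∀ x y, 0 ≤ K x y := by
    intro x y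
    refine mul_nonneg (by positivity) (Finset.prod_nonneg fun i _ => ?_)
    have : |ρ * (sgn (x i) * sgn (y i))| ≤ 1 := by simpa [abs_mul, abs_sgn] using hρ
    linarith [(abs_le.1 this).1]
  have hK1 : ∀ x, ∑ y, K x y = 1 := by
    intro x
    simp only [hK, ← Finset.mul_sum, sum_prod_one_add_sgn]
    exact inv_mul_cancel₀ (by positivity)
  have hKsymm : ∀ x y, K x y = K y x := by
    intro x y
    simp only [hK, mul_comm (sgn (x _))]
  have hconv : ∀ x, ∑ S : Finset (Fin n), ρ ^ S.card • chi S x • vhat f S = ∑ y, K x y • f y := by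
    intro x
    simp only [vhat, Finset.smul_sum, smul_smul, hK, ← sum_pow_card_mul_chi_mul_chi]
    rw [Finset.sum_comm]
    refine Finset.sum_congr rfl fun y _ => ?_
    rw [← Finset.sum_smul, Finset.mul_sum]
    congr 1
    refine Finset.sum_congr rfl fun S _ => by ring
  have hJ : ∀ x, ‖∑ y, K x y • f y‖ ^ 2 ≤ ∑ y, K x y * ‖f y‖ ^ 2 := by
    intro x
    have h1 : ‖∑ y, K x y • f y‖ ≤ ∑ y, K x y * ‖f y‖ := by
      refine (norm_sum_le _ _).trans (le_of_eq (Finset.sum_congr rfl fun y _ => ?_))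
      rw [norm_smul, Real.norm_of_nonneg (hK0 x y)]
    refine (pow_le_pow_left₀ (norm_nonneg _) h1 2).trans ?_
    exact Real.pow_arith_mean_le_arith_mean_pow _ _ _ (fun y _ => hK0 x y) (hK1 x)
      (fun y _ => norm_nonneg _) 2
  simp only [hconv]
  refine (Finset.sum_le_sum fun x _ => hJ x).trans (le_of_eq ?_)
  rw [Finset.sum_comm]
  refine Finset.sum_congr rfl fun y _ => ?_
  rw [← Finset.sum_mul]
  simp only [hKsymm _ y, hK1, one_mul]

lemma sum_abs_dual_chi_smul_vhat_le {m : ℕ} (b : Module.Basis (Fin m) ℝ E)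
    (hb : ∀ i, ‖b i‖ ≤ 1) (hcoord : ∀ i v, |b.repr v i| ≤ ‖v‖)
    (g : StrongDual ℝ (PiLp 2 fun _ : Fin n → Bool => E)) (hg : ‖g‖ ≤ 1)
    (f : (Fin n → Bool) → E) :
    ∑ S : Finset (Fin n), |g (WithLp.toLp 2 fun x => chi S x • vhat f S)| ≤
      m * ‖(WithLp.toLp 2 f : PiLp 2 fun _ : Fin n → Bool => E)‖ := by
  classical
  set F := ‖(WithLp.toLp 2 f : PiLp 2 fun _ : Fin n → Bool => E)‖ with hF
  have hgle : ∀ v, |g v| ≤ ‖v‖ := fun v => by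
    simpa using (g.le_opNorm v).trans (mul_le_of_le_one_left (norm_nonneg v) hg)
  set h : Fin m → (Fin n → Bool) → ℝ := fun i x => b.repr (f x) i with hh
  set d : Fin m → (Fin n → Bool) → ℝ := fun i x => g (WithLp.toLp 2 (Pi.single x (b i))) with hd
  have hsum : ∀ i (u : (Fin n → Bool) → ℝ),
      g (WithLp.toLp 2 fun x => u x • b i) = ∑ x, d i x * u x := by
    intro i u
    have : (WithLp.toLp 2 fun x => u x • b i : PiLp 2 fun _ : Fin n → Bool => E) =
        ∑ x, u x • WithLp.toLp 2 (Pi.single x (b i)) := by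
      ext y
      simp [Pi.single_apply]
    rw [this, map_sum]
    refine Finset.sum_congr rfl fun x _ => ?_
    rw [map_smul, smul_eq_mul, mul_comm]
  have hd1 : ∀ i, ∑ x, d i x ^ 2 ≤ 1 := by
    intro i
    have h1 : ∑ x, d i x ^ 2 ≤ Real.sqrt (∑ x, d i x ^ 2) := by
      calc ∑ x, d i x ^ 2 = g (WithLp.toLp 2 fun x => d i x • b i) := by
            rw [hsum]; simp only [sq]
        _ ≤ ‖(WithLp.toLp 2 fun x => d i x • b i : PiLp 2 fun _ : Fin n → Bool => E)‖ :=
            (le_abs_self _).trans (hgle _)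
        _ ≤ Real.sqrt (∑ x, d i x ^ 2) := by
            rw [PiLp.norm_eq_of_L2]
            refine Real.sqrt_le_sqrt (Finset.sum_le_sum fun x _ => ?_)
            simp only [norm_smul, mul_pow, Real.norm_eq_abs, sq_abs]
            exact mul_le_of_le_one_right (sq_nonneg _) (pow_le_one₀ (norm_nonneg _) (hb i))
    have h2 : 0 ≤ ∑ x, d i x ^ 2 := Finset.sum_nonneg fun x _ => sq_nonneg _
    have h3 := Real.sq_sqrt h2
    nlinarith [Real.sqrt_nonneg (∑ x, d i x ^ 2)]
  have hh1 : ∀ i, ∑ x, h i x ^ 2 ≤ F ^ 2 := by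
    intro i
    rw [hF, PiLp.norm_sq_eq_of_L2]
    refine Finset.sum_le_sum fun x _ => ?_
    rw [← sq_abs]
    exact pow_le_pow_left₀ (abs_nonneg _) (hcoord i (f x)) 2
  have hexp : ∀ S, g (WithLp.toLp 2 fun x => chi S x • vhat f S) =
      ∑ i, (2 ^ n : ℝ)⁻¹ * ((∑ x, h i x * chi S x) * ∑ x, d i x * chi S x) := by
    intro S
    have : (WithLp.toLp 2 fun x => chi S x • vhat f S : PiLp 2 fun _ : Fin n → Bool => E) =
        ∑ i, (b.repr (vhat f S) i) • WithLp.toLp 2 fun x => chi S x • b i := by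
      ext y
      conv_lhs => rw [← b.sum_repr (vhat f S)]
      simp only [Finset.smul_sum, smul_comm (chi S y)]
      simp
    rw [this, map_sum]
    refine Finset.sum_congr rfl fun i _ => ?_
    rw [map_smul, hsum, smul_eq_mul, ← mul_assoc]
    congr 1
    simp [vhat, hh, mul_comm]
  have hi : ∀ i, ∑ S, |(∑ x, h i x * chi S x) * ∑ x, d i x * chi S x| ≤ 2 ^ n * F := by
    intro i
    have hCS := Finset.sum_mul_sq_le_sq_mul_sq (Finset.univ : Finset (Finset (Fin n)))
      (fun S => |∑ x, h i x * chi S x|) (fun S => |∑ x, d i x * chi S x|)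
    simp only [sq_abs, sum_sq_sum_mul_chi] at hCS
    simp only [abs_mul]
    refine le_of_sq_le_sq (hCS.trans ?_) (by positivity)
    have h2 : 0 ≤ ∑ x, d i x ^ 2 := Finset.sum_nonneg fun x _ => sq_nonneg _
    calc (2 ^ n * ∑ x, h i x ^ 2) * (2 ^ n * ∑ x, d i x ^ 2)
        ≤ (2 ^ n * F ^ 2) * (2 ^ n * 1) := by gcongr; exacts [hh1 i, hd1 i]
      _ = _ := by ring
  calc _ ≤ ∑ S : Finset (Fin n), ∑ i, (2 ^ n : ℝ)⁻¹ *
          |(∑ x, h i x * chi S x) * ∑ x, d i x * chi S x| := by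
        refine Finset.sum_le_sum fun S _ => ?_
        rw [hexp]
        refine (Finset.abs_sum_le_sum_abs _ _).trans (le_of_eq (Finset.sum_congr rfl fun i _ => ?_))
        rw [abs_mul, abs_of_nonneg (by positivity)]
    _ = ∑ i, (2 ^ n : ℝ)⁻¹ * ∑ S, |(∑ x, h i x * chi S x) * ∑ x, d i x * chi S x| := by
        rw [Finset.sum_comm]; simp only [Finset.mul_sum]
    _ ≤ ∑ i : Fin m, (2 ^ n : ℝ)⁻¹ * (2 ^ n * F) := by
        gcongr with i; exact hi i
    _ = m * F := by simp

end

lemma exists_auerbach_basis (E : Type*) [NormedAddCommGroup E] [NormedSpace ℝ E]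
    [FiniteDimensional ℝ E] {m : ℕ} (hm : Module.finrank ℝ E = m) :
    ∃ b : Module.Basis (Fin m) ℝ E, (∀ i, ‖b i‖ ≤ 1) ∧ ∀ i v, |b.repr v i| ≤ ‖v‖ := by
  let e := Module.finBasisOfFinrankEq ℝ E hm
  have hcont : Continuous fun v : Fin m → E => |e.det v| := by
    simp only [Module.Basis.det_apply]
    refine (Continuous.matrix_det ?_).abs
    refine continuous_matrix fun i j => ?_
    exact (LinearMap.continuous_of_finiteDimensional (e.coord i)).comp (continuous_apply j)
  have : ProperSpace E := FiniteDimensional.proper ℝ E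
  have hcomp : IsCompact (Set.pi Set.univ fun _ : Fin m => Metric.closedBall (0 : E) 1) :=
    isCompact_univ_pi fun _ => isCompact_closedBall _ _
  obtain ⟨v, hv, hmax⟩ := hcomp.exists_isMaxOn
    ⟨0, fun i _ => by simp⟩ hcont.continuousOn
  have hv1 : ∀ i, ‖v i‖ ≤ 1 := fun i => by simpa using hv i trivial
  have hmax' : ∀ u : Fin m → E, (∀ i, ‖u i‖ ≤ 1) → |e.det u| ≤ |e.det v| := fun u hu =>
    hmax (fun i _ => by simpa using hu i)
  have hdet : 0 < |e.det v| := by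
    refine lt_of_lt_of_le ?_ (hmax' (fun i => ‖e i‖⁻¹ • e i) fun i => ?_)
    · have h1 := e.det.toMultilinearMap.map_smul_univ (fun i => ‖e i‖⁻¹) e
      simp only [AlternatingMap.coe_multilinearMap, Module.Basis.det_self] at h1
      rw [h1, abs_pos]
      simp [Finset.prod_eq_zero_iff, e.ne_zero]
    · rw [norm_smul, norm_inv, norm_norm, inv_mul_cancel₀ (norm_ne_zero_iff.2 (e.ne_zero i))]
  have hbasis := e.is_basis_iff_det.2 (isUnit_iff_ne_zero.2 (abs_pos.1 hdet))
  refine ⟨Module.Basis.mk hbasis.1 hbasis.2.ge, fun i => by simpa using hv1 i, fun i x => ?_⟩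
  rcases eq_or_ne x 0 with rfl | hx
  · rw [map_zero]; simp
  have hx' : 0 < ‖x‖ := norm_pos_iff.2 hx
  have h1 := LinearMap.congr_fun
    (e.det_smul_mk_coord_eq_det_update hbasis.1 hbasis.2.ge i) (‖x‖⁻¹ • x)
  have h2 := hmax' (Function.update v i (‖x‖⁻¹ • x)) fun j => by
    rcases eq_or_ne j i with rfl | hj
    · simp [norm_smul, hx'.ne']
    · simpa [hj] using hv1 j
  simp only [LinearMap.smul_apply, map_smul, smul_eq_mul, Module.Basis.coord_apply] at h1
  have h3 : e.det (Function.update v i (‖x‖⁻¹ • x)) =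
      e.det v * (‖x‖⁻¹ * (Module.Basis.mk hbasis.1 hbasis.2.ge).repr x i) := by
    rw [AlternatingMap.map_update_smul, smul_eq_mul, mul_left_comm, h1]
    rfl
  rw [h3, abs_mul, mul_le_iff_le_one_right hdet, abs_mul, abs_of_pos (by positivity),
    inv_mul_le_iff₀ hx', mul_one] at h2
  exact h2

lemma norm_toLp_homogeneous_le {E : Type*} [NormedAddCommGroup E] [NormedSpace ℝ E]
    [FiniteDimensional ℝ E] {m n ℓ : ℕ} (hm : Module.finrank ℝ E = m) (hℓ : 0 < ℓ)
    (f : (Fin n → Bool) → E) :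
    ‖(WithLp.toLp 2 fun x => ∑ S : Finset (Fin n) with S.card = ℓ, chi S x • vhat f S :
        PiLp 2 fun _ : Fin n → Bool => E)‖ ≤
      (4 + 6 * Real.log ((m : ℝ) + 1) / ℓ) ^ ℓ *
        ‖(WithLp.toLp 2 f : PiLp 2 fun _ : Fin n → Bool => E)‖ := by
  set F := ‖(WithLp.toLp 2 f : PiLp 2 fun _ : Fin n → Bool => E)‖ with hF
  rcases (norm_nonneg (WithLp.toLp 2 f : PiLp 2 fun _ : Fin n → Bool => E)).eq_or_lt with h0 | hpos
  · have hf : f = 0 := by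
      have := norm_eq_zero.1 h0.symm
      simpa using this
    have : ∀ S, vhat f S = 0 := fun S => by simp [vhat, hf]
    rw [hF, ← h0]
    simp only [this, smul_zero, Finset.sum_const_zero, mul_zero]
    exact (norm_zero (E := PiLp 2 fun _ : Fin n → Bool => E)).le
  rw [← hF] at hpos
  obtain ⟨b, hb, hcoord⟩ := exists_auerbach_basis E hm
  let level : Finset (Fin n) → PiLp 2 fun _ : Fin n → Bool => E :=
    fun S => WithLp.toLp 2 fun x => chi S x • vhat f S
  have hlevel : (WithLp.toLp 2 fun x => ∑ S : Finset (Fin n) with S.card = ℓ, chi S x • vhat f S :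
      PiLp 2 fun _ : Fin n → Bool => E) = ∑ S : Finset (Fin n) with S.card = ℓ, level S := by
    ext x
    simp [level]
  rw [hlevel]
  obtain ⟨g, hg, hgv⟩ := exists_dual_vector'' ℝ (∑ S : Finset (Fin n) with S.card = ℓ, level S)
  have hsum := sum_abs_dual_chi_smul_vhat_le b hb hcoord g hg f
  rw [← hF] at hsum
  let P : Polynomial ℂ := ∑ S : Finset (Fin n),
    Polynomial.C ((g (level S) : ℝ) : ℂ) * Polynomial.X ^ S.card
  have heval : ∀ z, P.eval z = ∑ S : Finset (Fin n), ((g (level S) : ℝ) : ℂ) * z ^ S.card := by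
    intro z
    simp [P, Polynomial.eval_finsetSum]
  have hcoeff : P.coeff ℓ = ((∑ S : Finset (Fin n) with S.card = ℓ, g (level S) : ℝ) : ℂ) := by
    rw [Finset.sum_filter, Complex.ofReal_sum]
    simp only [P, Polynomial.finsetSum_coeff, Polynomial.coeff_C_mul_X_pow, apply_ite Complex.ofReal,
      Complex.ofReal_zero, eq_comm]
  have hreal : ∀ x : ℝ, |x| ≤ 1 → ‖P.eval (x : ℂ)‖ ≤ F := by
    intro ρ hρ
    have h1 : P.eval (ρ : ℂ) = ((g (∑ S : Finset (Fin n), ρ ^ S.card • level S) : ℝ) : ℂ) := by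
      rw [heval, map_sum]
      push_cast
      refine Finset.sum_congr rfl fun S _ => ?_
      rw [map_smul, smul_eq_mul, mul_comm]
      push_cast
      rfl
    rw [h1, Complex.norm_real]
    refine ((g.le_opNorm _).trans (mul_le_of_le_one_left (norm_nonneg _) hg)).trans ?_
    refine le_of_sq_le_sq ?_ hpos.le
    rw [hF, PiLp.norm_sq_eq_of_L2, PiLp.norm_sq_eq_of_L2]
    simpa [level] using sum_norm_sq_noise_le f hρ
  have hdisc : ∀ z : ℂ, ‖z‖ ≤ 1 → ‖P.eval z‖ ≤ F * ((m : ℝ) + 1) := by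
    intro z hz
    rw [heval]
    calc _ ≤ ∑ S : Finset (Fin n), |g (level S)| := by
          refine (norm_sum_le _ _).trans (Finset.sum_le_sum fun S _ => ?_)
          rw [norm_mul, norm_pow, Complex.norm_real]
          exact mul_le_of_le_one_right (norm_nonneg _) (pow_le_one₀ (norm_nonneg _) hz)
      _ ≤ m * F := hsum
      _ ≤ F * ((m : ℝ) + 1) := by linarith
  have key := P.norm_coeff_le hpos (M := (m : ℝ) + 1) (by simp) hreal hdisc hℓ
  rw [hcoeff, Complex.norm_real, ← map_sum, hgv] at key
  simpa using key

/-- A copy of `Fin m → ℝ`, to be equipped with the norm `N`. -/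
def NormCopy {m : ℕ} (_ : (Fin m → ℝ) → ℝ) : Type := Fin m → ℝ

instance {m : ℕ} (N : (Fin m → ℝ) → ℝ) : AddCommGroup (NormCopy N) :=
  inferInstanceAs (AddCommGroup (Fin m → ℝ))

instance {m : ℕ} (N : (Fin m → ℝ) → ℝ) : Module ℝ (NormCopy N) :=
  inferInstanceAs (Module ℝ (Fin m → ℝ))

instance {m : ℕ} (N : (Fin m → ℝ) → ℝ) : Norm (NormCopy N) := ⟨N⟩

lemma NormCopy.core {m : ℕ} {N : (Fin m → ℝ) → ℝ}
    (N_add : ∀ v w, N (v + w) ≤ N v + N w)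
    (N_smul : ∀ (c : ℝ) v, N (c • v) = |c| * N v)
    (N_def : ∀ v, N v = 0 → v = 0) : NormedSpace.Core ℝ (NormCopy N) where
  norm_nonneg v := by
    change 0 ≤ N v
    revert v
    intro (v : Fin m → ℝ)
    have h0 : N 0 = 0 := by simpa using N_smul 0 0
    have h1 : N (-v) = N v := by rw [← neg_one_smul ℝ, N_smul]; simp
    have h2 := N_add v (-v)
    rw [add_neg_cancel, h0, h1] at h2
    linarith
  norm_smul c v := N_smul c v
  norm_triangle v w := N_add v w
  norm_eq_zero_iff v := by
    refine ⟨N_def v, ?_⟩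
    rintro rfl
    have h0 : N 0 = 0 := by simpa using N_smul 0 0
    exact h0

/-- Higher-degree Pisier inequality: for any norm `N` on `ℝ^m` and any
`f : {±1}^n → ℝ^m`, one has
`E[N(f_ℓ(X))²]^{1/2} ≤ (4 + 6 log(m+1)/ℓ)^ℓ · E[N(f(X))²]^{1/2}`. -/
theorem stmt6 (ℓ m n : ℕ) (hℓ : 0 < ℓ) (hm : 0 < m) (hn : 0 < n)
    (N : (Fin m → ℝ) → ℝ)
    (N_add : ∀ v w, N (v + w) ≤ N v + N w)
    (N_smul : ∀ (c : ℝ) v, N (c • v) = |c| * N v)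
    (N_def : ∀ v, N v = 0 → v = 0)
    (f : (Fin n → Bool) → (Fin m → ℝ)) :
    Real.sqrt ((∑ x : Fin n → Bool, N (homPartV f ℓ x) ^ 2) / 2 ^ n) ≤
      (4 + 6 * Real.log ((m : ℝ) + 1) / ℓ) ^ ℓ *
        Real.sqrt ((∑ x : Fin n → Bool, N (f x) ^ 2) / 2 ^ n) := by
  let _ : NormedAddCommGroup (NormCopy N) :=
    NormedAddCommGroup.ofCore (NormCopy.core N_add N_smul N_def)
  let _ : NormedSpace ℝ (NormCopy N) := NormedSpace.ofCore (NormCopy.core N_add N_smul N_def)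
  have : FiniteDimensional ℝ (NormCopy N) := inferInstanceAs (FiniteDimensional ℝ (Fin m → ℝ))
  have hfr : Module.finrank ℝ (NormCopy N) = m :=
    Module.finrank_fin_fun (n := m) ℝ
  have key := norm_toLp_homogeneous_le (E := NormCopy N) hfr hℓ f
  have hhom : ∀ x, homPartV f ℓ x =
      ∑ S : Finset (Fin n) with S.card = ℓ, chi S x • vhat (E := NormCopy N) f S := by
    intro x
    change homPartV f ℓ x = ∑ S : Finset (Fin n) with S.card = ℓ,
      chi S x • ((2 ^ n : ℝ)⁻¹ • ∑ y, chi S y • f y : Fin m → ℝ)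
    ext i
    simp only [homPartV, fcoeffV, Finset.sum_apply, Pi.smul_apply, smul_eq_mul]
    refine Finset.sum_congr rfl fun S _ => ?_
    simp only [mul_comm (f _ i)]
    ring
  rw [PiLp.norm_eq_of_L2, PiLp.norm_eq_of_L2] at key
  rw [Real.sqrt_div' _ (by positivity), Real.sqrt_div' _ (by positivity), ← mul_div_assoc]
  refine div_le_div_of_nonneg_right ?_ (Real.sqrt_nonneg _)
  simp only [hhom]
  exact key
end

section
/- Let 1 ≤ ℓ ≤ n and let f : {±1}^n → ℝ. Let Q ⊆ [n] be a random subset obtained by including each coordinate independently with probability 1/ℓ, and let Z be uniform on {±1}^n, independent of Q. Define the random restriction g(x) := Σ_{S⊆[n], |S|=ℓ} f̂(S)·χ_{S∖Q}(x)·χ_{S∩Q}(Z). Then ‖f̂_ℓ‖_1 ≤ e·√(2n/ℓ)·E_{Q,Z}[‖ĝ_{ℓ−1}‖_1], where ‖ĝ_{ℓ−1}‖_1 = Σ_{U : |U|=ℓ−1} |ĝ(U)|. -/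
open Finset

theorem sgn_not (b : Bool) : sgn (!b) = -sgn b := by cases b <;> simp [sgn]

theorem sgn_eq_one_or_neg_one (b : Bool) : sgn b = 1 ∨ sgn b = -1 := by cases b <;> simp [sgn]

theorem sum_sgn_update_of_notMem {ι : Type*} [DecidableEq ι] {Q : Finset ι} {j : ι}
    (hj : j ∉ Q) (s : ι → ℝ) (z : ι → Bool) (b : Bool) :
    ∑ i ∈ Q, sgn (Function.update z j b i) * s i = ∑ i ∈ Q, sgn (z i) * s i := by
  refine sum_congr rfl fun i hi => ?_
  rw [Function.update_of_ne (by rintro rfl; exact hj hi)]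

section Rademacher

variable {ι : Type*} [Fintype ι] [DecidableEq ι]

/-- Averaging out one coordinate of the cube. -/
theorem two_mul_sum_sgn_coord (j : ι) {c : ℝ} (hc : c = 1 ∨ c = -1) (G : ℝ → ℝ → ℝ)
    (Y : (ι → Bool) → ℝ) (hY : ∀ z b, Y (Function.update z j b) = Y z) :
    2 * ∑ z : ι → Bool, G (sgn (z j) * c) (Y z) = ∑ z : ι → Bool, (G 1 (Y z) + G (-1) (Y z)) := by
  have hinv : Function.Involutive fun z : ι → Bool => Function.update z j (!z j) := by
    intro z; simp
  have hflip : ∑ z : ι → Bool, G (sgn (z j) * c) (Y z) =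
      ∑ z : ι → Bool, G (-(sgn (z j) * c)) (Y z) := by
    rw [← Equiv.sum_comp hinv.toPerm]
    refine sum_congr rfl fun z _ => ?_
    simp [Function.Involutive.coe_toPerm, hY, sgn_not]
  rw [two_mul]
  nth_rewrite 2 [hflip]
  rw [← sum_add_distrib]
  refine sum_congr rfl fun z _ => ?_
  rcases sgn_eq_one_or_neg_one (z j) with h | h <;> rcases hc with h' | h' <;>
    simp [h, h', add_comm]

/-- A signed Rademacher sum over `Q` has the centred binomial distribution. -/
theorem sum_comp_rademacher (Q : Finset ι) (s : ι → ℝ) (hs : ∀ i, s i = 1 ∨ s i = -1)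
    (φ : ℝ → ℝ) :
    2 ^ #Q * ∑ z : ι → Bool, φ (∑ i ∈ Q, sgn (z i) * s i) =
      2 ^ Fintype.card ι *
        ∑ k ∈ range (#Q + 1), ((#Q).choose k : ℝ) * φ ((k : ℝ) - ((#Q - k : ℕ) : ℝ)) := by
  induction Q using Finset.induction_on generalizing φ with
  | empty => simp
  | insert j Q hj ih =>
    have h := two_mul_sum_sgn_coord j (hs j) (fun x y => φ (x + y))
      (fun z => ∑ i ∈ Q, sgn (z i) * s i) (fun z b => sum_sgn_update_of_notMem hj s z b)
    simp only [sum_insert hj, card_insert_of_notMem hj, pow_succ, mul_assoc]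
    rw [h, sum_add_distrib, mul_add, ih (fun y => φ (1 + y)), ih (fun y => φ (-1 + y)),
      sum_choose_succ_mul (fun a b => φ ((a : ℝ) - (b : ℝ))) #Q, ← mul_add, add_comm]
    congr 2 <;> refine sum_congr rfl fun k hk => ?_
    · rw [Nat.succ_sub (Nat.lt_succ_iff.1 (mem_range.1 hk))]
      push_cast
      congr 2
      ring
    · push_cast
      congr 2
      ring

end Rademacher

theorem sixteen_pow_le_mul_centralBinom_sq (k : ℕ) (hk : 1 ≤ k) :
    16 ^ k ≤ 4 * k * k.centralBinom ^ 2 := by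
  induction k, hk using Nat.le_induction with
  | base => decide
  | succ k hk ih =>
    have h := Nat.succ_mul_centralBinom_succ k
    have h2 : (k + 1) * 16 ^ (k + 1) ≤ (k + 1) * (4 * (k + 1) * (k + 1).centralBinom ^ 2) := by
      calc (k + 1) * 16 ^ (k + 1) = 16 * (k + 1) * 16 ^ k := by ring
        _ ≤ 16 * (k + 1) * (4 * k * k.centralBinom ^ 2) := by gcongr
        _ = 16 * (4 * k * (k + 1)) * k.centralBinom ^ 2 := by ring
        _ ≤ 16 * (2 * k + 1) ^ 2 * k.centralBinom ^ 2 := by gcongr; nlinarith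
        _ = 4 * (2 * (2 * k + 1) * k.centralBinom) ^ 2 := by ring
        _ = 4 * ((k + 1) * (k + 1).centralBinom) ^ 2 := by rw [h]
        _ = _ := by ring
    exact Nat.le_of_mul_le_mul_left h2 k.succ_pos

theorem inv_sqrt_le_centralBinom_div (k : ℕ) (hk : 1 ≤ k) :
    1 / √(4 * k : ℝ) ≤ k.centralBinom / 4 ^ k := by
  have hk' : (0 : ℝ) < k := by exact_mod_cast hk
  rw [div_le_div_iff₀ (by positivity) (by positivity), one_mul]
  refine le_of_sq_le_sq ?_ (by positivity)
  rw [mul_pow, Real.sq_sqrt (by positivity), ← pow_mul, mul_comm k 2, pow_mul]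
  have := sixteen_pow_le_mul_centralBinom_sq k hk
  have h : (16 : ℝ) ^ k ≤ 4 * k * k.centralBinom ^ 2 := by exact_mod_cast this
  norm_num
  linarith

theorem sign_mono : Monotone Real.sign := by
  intro x y h
  rcases lt_trichotomy x 0 with hx | hx | hx <;> rcases lt_trichotomy y 0 with hy | hy | hy <;>
    simp [Real.sign_of_neg, Real.sign_of_pos, hx, hy] <;> linarith

/-- The influence of one vote on the majority of `m + 1` votes is at least `1 / √(2 (m + 1))`. -/
theorem inv_sqrt_le_sum_choose_sign (m : ℕ) :
    2 ^ m * (1 / √(2 * (m + 1) : ℝ)) ≤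
      (∑ k ∈ range (m + 1), (m.choose k : ℝ) *
        (Real.sign (1 + ((k : ℝ) - ((m - k : ℕ) : ℝ))) -
          Real.sign (-1 + ((k : ℝ) - ((m - k : ℕ) : ℝ))))) / 2 := by
  have hnn : ∀ k ∈ range (m + 1), 0 ≤ (m.choose k : ℝ) *
        (Real.sign (1 + ((k : ℝ) - ((m - k : ℕ) : ℝ))) -
          Real.sign (-1 + ((k : ℝ) - ((m - k : ℕ) : ℝ)))) := fun k _ =>
    mul_nonneg (Nat.cast_nonneg _) (sub_nonneg.2 (sign_mono (by linarith)))
  rcases Nat.even_or_odd' m with ⟨k, rfl | rfl⟩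
  · have h := single_le_sum hnn (mem_range.2 (by omega : k < 2 * k + 1))
    rw [show 2 * k - k = k by omega] at h
    simp only [sub_self, add_zero, Real.sign_one, Real.sign_neg] at h
    rw [le_div_iff₀ two_pos]
    refine le_trans ?_ h
    have hb : 1 / √(2 * ((2 * k : ℕ) + 1) : ℝ) ≤ k.centralBinom / 4 ^ k := by
      rcases Nat.eq_zero_or_pos k with rfl | hk
      · simp only [mul_zero, Nat.cast_zero, zero_add, mul_one, Nat.centralBinom_zero, Nat.cast_one,
          pow_zero, div_one]
        exact div_le_one_of_le₀ (Real.one_le_sqrt.2 (by norm_num)) (Real.sqrt_nonneg _)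
      · refine le_trans ?_ (inv_sqrt_le_centralBinom_div k hk)
        have hk' : (0 : ℝ) < k := by exact_mod_cast hk
        apply one_div_le_one_div_of_le (by positivity)
        apply Real.sqrt_le_sqrt
        push_cast
        linarith
    rw [le_div_iff₀ (by positivity)] at hb
    rw [pow_mul, ← Nat.centralBinom_eq_two_mul_choose]
    norm_num at hb ⊢
    linarith
  · have h := sum_le_sum_of_subset_of_nonneg (s := {k, k + 1}) (t := range (2 * k + 1 + 1))
      (by intro i; simp; omega) (fun i hi _ => hnn i hi)
    rw [sum_pair (by omega)] at h
    rw [le_div_iff₀ two_pos]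
    refine le_trans ?_ h
    rw [show 2 * k + 1 - k = k + 1 by omega, show 2 * k + 1 - (k + 1) = k by omega]
    have hb := inv_sqrt_le_centralBinom_div (k + 1) (by omega)
    rw [le_div_iff₀ (by positivity)] at hb
    have hc : (((k + 1).centralBinom : ℕ) : ℝ) =
        (2 * k + 1).choose k + (2 * k + 1).choose (k + 1) := by
      rw [Nat.centralBinom_eq_two_mul_choose, mul_add, mul_one, Nat.choose_succ_succ]
      push_cast
      rfl
    have e1 : Real.sign (1 + ((k : ℝ) - ((k + 1 : ℕ) : ℝ))) = 0 := by
      push_cast; rw [← Real.sign_zero]; congr 1; ring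
    have e2 : Real.sign (-1 + ((k : ℝ) - ((k + 1 : ℕ) : ℝ))) = -1 :=
      Real.sign_of_neg (by push_cast; linarith)
    have e3 : Real.sign (1 + (((k + 1 : ℕ) : ℝ) - (k : ℝ))) = 1 :=
      Real.sign_of_pos (by push_cast; linarith)
    have e4 : Real.sign (-1 + (((k + 1 : ℕ) : ℝ) - (k : ℝ))) = 0 := by
      push_cast; rw [← Real.sign_zero]; congr 1; ring
    rw [e1, e2, e3, e4]
    have e5 : (2 * ((2 * k + 1 : ℕ) + 1) : ℝ) = 4 * (k + 1 : ℕ) := by push_cast; ring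
    have e6 : (4 : ℝ) ^ (k + 1) = 2 ^ (2 * k + 1) * 2 := by
      rw [← pow_succ, show 2 * k + 1 + 1 = 2 * (k + 1) by ring, pow_mul]; norm_num
    rw [e5]
    rw [hc, e6] at hb
    linarith

/-- Khintchine's inequality in `ℓ¹` form, with the constant of Szarek. -/
theorem sum_abs_div_sqrt_le_expect_abs_rademacher {ι : Type*} [Fintype ι] [DecidableEq ι]
    (Q : Finset ι) (a : ι → ℝ) :
    1 / √(2 * #Q : ℝ) * ∑ j ∈ Q, |a j| ≤
      (∑ z : ι → Bool, |∑ j ∈ Q, sgn (z j) * a j|) / 2 ^ Fintype.card ι := by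
  obtain ⟨s, hs, hsa⟩ : ∃ s : ι → ℝ, (∀ i, s i = 1 ∨ s i = -1) ∧ ∀ i, a i = s i * |a i| := by
    refine ⟨fun i => if 0 ≤ a i then 1 else -1, fun i => ?_, fun i => ?_⟩
    · dsimp only; split_ifs <;> simp
    · dsimp only; split_ifs with h
      · rw [abs_of_nonneg h, one_mul]
      · rw [abs_of_neg (not_le.1 h)]; ring
  have hinf : ∀ j ∈ Q, 2 ^ Fintype.card ι * (1 / √(2 * #Q : ℝ)) ≤
      ∑ z : ι → Bool, Real.sign (∑ i ∈ Q, sgn (z i) * s i) * (sgn (z j) * s j) := by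
    intro j hj
    have h1 := two_mul_sum_sgn_coord j (hs j) (fun x y => Real.sign (x + y) * x)
      (fun z => ∑ i ∈ Q.erase j, sgn (z i) * s i)
      (fun z b => sum_sgn_update_of_notMem (notMem_erase j Q) s z b)
    have h2 := sum_comp_rademacher (Q.erase j) s hs
      (fun y => Real.sign (1 + y) - Real.sign (-1 + y))
    have h3 := inv_sqrt_le_sum_choose_sign #(Q.erase j)
    have hc : (#Q : ℝ) = #(Q.erase j) + 1 := by
      rw [← card_erase_add_one hj]; push_cast; rfl
    simp only [add_sum_erase Q (fun i => sgn (_ : Bool) * s i) hj, mul_one, mul_neg,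
      ← sub_eq_add_neg] at h1
    rw [hc]
    rw [← h1] at h2
    have hp : (0 : ℝ) < 2 ^ #(Q.erase j) := by positivity
    have hp' : (0 : ℝ) < 2 ^ Fintype.card ι := by positivity
    refine le_of_mul_le_mul_left ?_ hp
    have := mul_le_mul_of_nonneg_left h3 hp'.le
    linarith
  rw [le_div_iff₀ (by positivity)]
  calc (1 / √(2 * #Q : ℝ) * ∑ j ∈ Q, |a j|) * 2 ^ Fintype.card ι
      = ∑ j ∈ Q, |a j| * (2 ^ Fintype.card ι * (1 / √(2 * #Q : ℝ))) := by
        rw [mul_sum, sum_mul]; exact sum_congr rfl fun j _ => by ring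
    _ ≤ ∑ j ∈ Q, |a j| * ∑ z : ι → Bool,
          Real.sign (∑ i ∈ Q, sgn (z i) * s i) * (sgn (z j) * s j) :=
        sum_le_sum fun j hj => mul_le_mul_of_nonneg_left (hinf j hj) (abs_nonneg _)
    _ = ∑ z : ι → Bool, Real.sign (∑ i ∈ Q, sgn (z i) * s i) * ∑ j ∈ Q, sgn (z j) * a j := by
        simp only [mul_sum]
        rw [sum_comm]
        refine sum_congr rfl fun z _ => sum_congr rfl fun j _ => ?_
        rw [show sgn (z j) * a j = sgn (z j) * (s j * |a j|) by rw [← hsa j]]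
        ring
    _ ≤ _ := by
        refine sum_le_sum fun z _ => (le_abs_self _).trans ?_
        rw [abs_mul]
        refine mul_le_of_le_one_left (abs_nonneg _) ?_
        rcases Real.sign_apply_eq (∑ i ∈ Q, sgn (z i) * s i) with h | h | h <;> simp [h]

/-- A tangent line bound for the convex function `x ↦ 1 / √x`. -/
theorem one_div_sqrt_tangent_le {c x : ℝ} (hc : 0 < c) (hx : 0 < x) :
    1 / √c * (3 / 2 - x / (2 * c)) ≤ 1 / √x := by
  obtain ⟨v, hv, rfl⟩ : ∃ v, 0 < v ∧ c = v ^ 2 :=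
    ⟨√c, Real.sqrt_pos.2 hc, (Real.sq_sqrt hc.le).symm⟩
  obtain ⟨u, hu, rfl⟩ : ∃ u, 0 < u ∧ x = u ^ 2 :=
    ⟨√x, Real.sqrt_pos.2 hx, (Real.sq_sqrt hx.le).symm⟩
  rw [Real.sqrt_sq hu.le, Real.sqrt_sq hv.le, ← sub_nonneg]
  have h : 1 / u - 1 / v * (3 / 2 - u ^ 2 / (2 * v ^ 2)) =
      (u - v) ^ 2 * (u + 2 * v) / (2 * u * v ^ 3) := by
    field_simp
    ring
  rw [h]
  positivity

/-- The expectation of an affine function of the size of a `p`-random subset. -/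
theorem sum_powerset_pow_mul_affine {ι : Type*} (V : Finset ι) (p α β : ℝ) :
    ∑ R ∈ V.powerset, p ^ #R * (1 - p) ^ (#V - #R) * (α + β * #R) = α + β * (#V * p) := by
  have h0 := congrArg (Polynomial.eval p) (bernsteinPolynomial.sum ℝ #V)
  have h1 := congrArg (Polynomial.eval p) (bernsteinPolynomial.sum_smul ℝ #V)
  simp only [bernsteinPolynomial, Polynomial.eval_finsetSum, Polynomial.eval_mul,
    Polynomial.eval_natCast, Polynomial.eval_pow, Polynomial.eval_X, Polynomial.eval_sub,
    Polynomial.eval_one, nsmul_eq_mul] at h0 h1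
  rw [sum_powerset_apply_card (fun r => p ^ r * (1 - p) ^ (#V - r) * (α + β * r)), ← h1]
  refine Eq.trans ?_ (congrArg (· + _) ((congrArg (α * ·) h0).trans (mul_one α)))
  simp only [mul_sum, ← sum_add_distrib]
  refine sum_congr rfl fun r _ => ?_
  rw [nsmul_eq_mul]
  ring

theorem one_le_exp_one_mul_one_sub_inv_pow {ℓ : ℕ} (hℓ : 1 ≤ ℓ) :
    1 ≤ Real.exp 1 * (1 - 1 / (ℓ : ℝ)) ^ (ℓ - 1) := by
  obtain ⟨k, rfl⟩ := Nat.exists_eq_add_of_le' hℓ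
  rcases Nat.eq_zero_or_pos k with rfl | hk
  · simp
  have hk' : (0 : ℝ) < k := by exact_mod_cast hk
  have h : (1 + 1 / (k : ℝ)) ^ k ≤ Real.exp 1 := by
    calc (1 + 1 / (k : ℝ)) ^ k ≤ Real.exp (1 / k) ^ k := by
          gcongr
          linarith [Real.add_one_le_exp (1 / (k : ℝ))]
      _ = Real.exp 1 := by
          rw [← Real.exp_nat_mul]
          congr 1
          field_simp
  have h' : (1 + 1 / (k : ℝ)) * (1 - 1 / ((k + 1 : ℕ) : ℝ)) = 1 := by
    push_cast
    field_simp
    ring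
  rw [Nat.add_sub_cancel]
  calc (1 : ℝ) = (1 + 1 / (k : ℝ)) ^ k * (1 - 1 / ((k + 1 : ℕ) : ℝ)) ^ k := by
        rw [← mul_pow, h', one_pow]
    _ ≤ _ := by
        refine mul_le_mul_of_nonneg_right h (pow_nonneg (sub_nonneg.2 ?_) _)
        exact div_le_one_of_le₀ (by push_cast; linarith) (Nat.cast_nonneg _)

theorem le_sum_random_subset_weight {n ℓ : ℕ} (hℓ : 1 ≤ ℓ) (hn : ℓ ≤ n) {U : Finset (Fin n)}
    (hU : #U = ℓ - 1) {j : Fin n} (hj : j ∉ U) :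
    1 / (ℓ : ℝ) * (1 - 1 / (ℓ : ℝ)) ^ (ℓ - 1) * (1 / √(2 * n / ℓ)) ≤
      ∑ Q : Finset (Fin n), (1 / (ℓ : ℝ)) ^ #Q * (1 - 1 / (ℓ : ℝ)) ^ (n - #Q) *
        ((if Q ∩ U = ∅ then (1 : ℝ) else 0) * if j ∈ Q then 1 / √(2 * #Q : ℝ) else 0) := by
  have hℓ' : (1 : ℝ) ≤ ℓ := by exact_mod_cast hℓ
  have hn' : (ℓ : ℝ) ≤ n := by exact_mod_cast hn
  have hn0 : (0 : ℝ) < n := by linarith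
  set p : ℝ := 1 / (ℓ : ℝ) with hp
  have hp0 : 0 ≤ p := by positivity
  have hq0 : 0 ≤ 1 - p := sub_nonneg.2 (div_le_one_of_le₀ hℓ' (by linarith))
  set V : Finset (Fin n) := (insert j U)ᶜ with hV
  have hVc : #V = n - ℓ := by
    rw [hV, card_compl, card_insert_of_notMem hj, hU, Fintype.card_fin]
    omega
  have hjV : ∀ R ∈ V.powerset, j ∉ R := fun R hR hjR => by
    have := mem_powerset.1 hR hjR
    simp [hV] at this
  have hinj : Set.InjOn (insert j) (V.powerset : Set (Finset (Fin n))) := by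
    intro R hR R' hR' h
    rw [← erase_insert (hjV R hR), ← erase_insert (hjV R' hR'), h]
  refine le_trans ?_ (sum_le_sum_of_subset_of_nonneg (subset_univ (V.powerset.image (insert j)))
    fun Q _ _ => ?_)
  swap
  · refine mul_nonneg (mul_nonneg (pow_nonneg hp0 _) (pow_nonneg hq0 _)) (mul_nonneg ?_ ?_) <;>
      split_ifs <;> positivity
  rw [sum_image hinj]
  have hc : 0 < 2 * (n : ℝ) / ℓ := by positivity
  have key := sum_powerset_pow_mul_affine V p
    (1 / √(2 * n / ℓ) * (3 / 2 - ℓ / (2 * n))) (-(1 / √(2 * n / ℓ) * (ℓ / (2 * n))))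
  have hmean : 1 / √(2 * n / ℓ) * (3 / 2 - (ℓ : ℝ) / (2 * n)) +
      -(1 / √(2 * n / ℓ) * (ℓ / (2 * n))) * (#V * p) = 1 / √(2 * n / ℓ) := by
    have : (3 / 2 - (ℓ : ℝ) / (2 * n)) - ℓ / (2 * n) * (#V * p) = 1 := by
      rw [hVc, Nat.cast_sub hn, hp]
      field_simp
      ring
    linear_combination (1 / √(2 * n / ℓ)) * this
  rw [hmean] at key
  rw [← key, mul_sum]
  refine sum_le_sum fun R hR => ?_
  have hjR := hjV R hR
  have hRc : #R ≤ n - ℓ := hVc ▸ card_le_card (mem_powerset.1 hR)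
  have hdisj : insert j R ∩ U = ∅ := by
    rw [← disjoint_iff_inter_eq_empty, disjoint_insert_left]
    refine ⟨hj, disjoint_left.2 fun i hi hiU => ?_⟩
    have := mem_powerset.1 hR hi
    simp [hV, hiU] at this
  rw [if_pos hdisj, if_pos (mem_insert_self _ _), card_insert_of_notMem hjR, one_mul, hVc,
    show n - (#R + 1) = (ℓ - 1) + (n - ℓ - #R) by omega, pow_add (1 - p), pow_succ p]
  have ht := one_div_sqrt_tangent_le hc (x := 2 * ((#R + 1 : ℕ) : ℝ)) (by positivity)
  have hx : 3 / 2 - 2 * ((#R + 1 : ℕ) : ℝ) / (2 * (2 * n / ℓ)) =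
      (3 / 2 - (ℓ : ℝ) / (2 * n)) - ℓ / (2 * n) * #R := by
    push_cast
    field_simp
    ring
  rw [hx] at ht
  have hw : 0 ≤ p ^ #R * p * ((1 - p) ^ (ℓ - 1) * (1 - p) ^ (n - ℓ - #R)) := by positivity
  refine le_trans (le_of_eq ?_) (mul_le_mul_of_nonneg_left ht hw)
  ring

/-- Each `ℓ`-set arises from exactly `ℓ` pairs of an `(ℓ - 1)`-set and a further element. -/
theorem sum_card_pred_sum_compl_insert {ι : Type*} [Fintype ι] [DecidableEq ι] {ℓ : ℕ} (hℓ : 1 ≤ ℓ)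
    (h : Finset ι → ℝ) :
    ∑ U ∈ univ.filter (fun U : Finset ι => #U = ℓ - 1), ∑ j ∈ Uᶜ, h (insert j U) =
      ℓ * ∑ S ∈ univ.filter (fun S : Finset ι => #S = ℓ), h S := by
  have h2 : (ℓ : ℝ) * ∑ S ∈ univ.filter (fun S : Finset ι => #S = ℓ), h S =
      ∑ S ∈ univ.filter (fun S : Finset ι => #S = ℓ), ∑ _j ∈ S, h S := by
    rw [mul_sum]
    refine sum_congr rfl fun S hS => ?_
    rw [sum_const, (mem_filter.1 hS).2, nsmul_eq_mul]
  rw [h2, sum_sigma', sum_sigma']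
  refine sum_bij' (fun x _ => ⟨insert x.2 x.1, x.2⟩) (fun x _ => ⟨x.1.erase x.2, x.2⟩)
    ?_ ?_ ?_ ?_ ?_
  · rintro ⟨U, j⟩ hx
    simp only [mem_sigma, mem_filter, mem_univ, true_and, mem_compl] at hx ⊢
    rw [card_insert_of_notMem hx.2]
    exact ⟨by omega, mem_insert_self _ _⟩
  · rintro ⟨S, j⟩ hx
    simp only [mem_sigma, mem_filter, mem_univ, true_and, mem_compl] at hx ⊢
    rw [card_erase_of_mem hx.2]
    exact ⟨by omega, notMem_erase _ _⟩
  · rintro ⟨U, j⟩ hx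
    simp only [mem_sigma, mem_compl] at hx
    simp [erase_insert hx.2]
  · rintro ⟨S, j⟩ hx
    simp only [mem_sigma] at hx
    simp [insert_erase hx.2]
  · rintro ⟨U, j⟩ _
    rfl

/-- The expected `ℓ¹` mass of the restricted coefficients for a fixed set `Q`. -/
theorem sum_weight_mul_abs_le_expect {n : ℕ} (F : Finset (Finset (Fin n))) (Q : Finset (Fin n))
    (c : Finset (Fin n) → ℝ) :
    ∑ U ∈ F, ∑ j ∈ Uᶜ, (if Q ∩ U = ∅ then (1 : ℝ) else 0) *
        (if j ∈ Q then 1 / √(2 * #Q : ℝ) else 0) * |c (insert j U)| ≤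
      (∑ z : Fin n → Bool, ∑ U ∈ F, |(if Q ∩ U = ∅ then (1 : ℝ) else 0) *
        ∑ j ∈ Q \ U, sgn (z j) * c (insert j U)|) / 2 ^ n := by
  rw [sum_comm, sum_div]
  refine sum_le_sum fun U _ => ?_
  split_ifs with hQU
  · have hd : Disjoint Q U := disjoint_iff_inter_eq_empty.2 hQU
    have h := sum_abs_div_sqrt_le_expect_abs_rademacher Q fun j => c (insert j U)
    rw [Fintype.card_fin] at h
    simp only [one_mul, sdiff_eq_self_of_disjoint hd]
    refine le_trans (le_of_eq ?_) h
    simp only [ite_mul, zero_mul]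
    rw [← sum_filter, mul_sum]
    refine sum_congr ?_ fun _ _ => rfl
    ext i
    simp only [mem_filter, mem_compl, and_iff_right_iff_imp]
    exact fun hi => disjoint_left.1 hd hi
  · simp

/-- Random restriction lemma: for `1 ≤ ℓ ≤ n` and `f : {±1}^n → ℝ`, with `Q ⊆ [n]` a random
subset including each coordinate independently with probability `1/ℓ` and `Z` uniform on
`{±1}^n` independent of `Q`, the random restriction `g` (with Fourier coefficients
`ĝ(U) = 1_{Q∩U=∅} · Σ_{j∈Q∖U} Z_j f̂(U∪{j})` for `|U| = ℓ−1`) satisfies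
`‖f̂_ℓ‖_1 ≤ e·√(2n/ℓ)·E_{Q,Z}[‖ĝ_{ℓ−1}‖_1]`. -/
theorem stmt10 (n ℓ : ℕ) (hℓ : 1 ≤ ℓ) (hn : ℓ ≤ n) (f : (Fin n → Bool) → ℝ) :
    ∑ S ∈ Finset.univ.filter (fun S : Finset (Fin n) => S.card = ℓ), |fcoeff f S| ≤
      Real.exp 1 * Real.sqrt (2 * n / ℓ) *
        ∑ Q : Finset (Fin n),
          (1 / (ℓ : ℝ)) ^ Q.card * (1 - 1 / (ℓ : ℝ)) ^ (n - Q.card) *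
            ((∑ z : Fin n → Bool,
                ∑ U ∈ Finset.univ.filter (fun U : Finset (Fin n) => U.card = ℓ - 1),
                  |(if Q ∩ U = ∅ then (1 : ℝ) else 0) *
                    ∑ j ∈ Q \ U, sgn (z j) * fcoeff f (insert j U)|) / 2 ^ n) := by
  have hℓ' : (1 : ℝ) ≤ ℓ := by exact_mod_cast hℓ
  have hn' : (ℓ : ℝ) ≤ n := by exact_mod_cast hn
  have hn0 : (0 : ℝ) < n := by linarith
  have hp0 : 0 ≤ 1 / (ℓ : ℝ) := by positivity
  have hq0 : 0 ≤ 1 - 1 / (ℓ : ℝ) := sub_nonneg.2 (div_le_one_of_le₀ hℓ' (by linarith))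
  set F := univ.filter fun U : Finset (Fin n) => #U = ℓ - 1 with hF
  set A := ∑ S ∈ univ.filter (fun S : Finset (Fin n) => #S = ℓ), |fcoeff f S| with hA
  have hA0 : 0 ≤ A := sum_nonneg fun _ _ => abs_nonneg _
  set q := (1 - 1 / (ℓ : ℝ)) ^ (ℓ - 1) with hq
  have hsqrt : 0 < √(2 * n / ℓ : ℝ) := Real.sqrt_pos.2 (by positivity)
  calc A ≤ Real.exp 1 * q * A :=
        le_mul_of_one_le_left hA0 (one_le_exp_one_mul_one_sub_inv_pow hℓ)
    _ = Real.exp 1 * √(2 * n / ℓ) * (1 / (ℓ : ℝ) * q * (1 / √(2 * n / ℓ)) * (ℓ * A)) := by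
        field_simp
    _ = Real.exp 1 * √(2 * n / ℓ) * ∑ U ∈ F, ∑ j ∈ Uᶜ,
          1 / (ℓ : ℝ) * q * (1 / √(2 * n / ℓ)) * |fcoeff f (insert j U)| := by
        rw [hA, ← sum_card_pred_sum_compl_insert hℓ fun S => |fcoeff f S|]
        simp only [mul_sum, hF]
    _ ≤ Real.exp 1 * √(2 * n / ℓ) * ∑ U ∈ F, ∑ j ∈ Uᶜ,
          (∑ Q : Finset (Fin n), (1 / (ℓ : ℝ)) ^ #Q * (1 - 1 / (ℓ : ℝ)) ^ (n - #Q) *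
            ((if Q ∩ U = ∅ then (1 : ℝ) else 0) * if j ∈ Q then 1 / √(2 * #Q : ℝ) else 0)) *
            |fcoeff f (insert j U)| := by
        refine mul_le_mul_of_nonneg_left (sum_le_sum fun U hU => sum_le_sum fun j hj => ?_)
          (by positivity)
        exact mul_le_mul_of_nonneg_right (le_sum_random_subset_weight hℓ hn (mem_filter.1 hU).2
          (mem_compl.1 hj)) (abs_nonneg _)
    _ = Real.exp 1 * √(2 * n / ℓ) * ∑ Q : Finset (Fin n),
          (1 / (ℓ : ℝ)) ^ #Q * (1 - 1 / (ℓ : ℝ)) ^ (n - #Q) *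
            ∑ U ∈ F, ∑ j ∈ Uᶜ, (if Q ∩ U = ∅ then (1 : ℝ) else 0) *
              (if j ∈ Q then 1 / √(2 * #Q : ℝ) else 0) * |fcoeff f (insert j U)| := by
        congr 1
        simp only [sum_mul, mul_sum, mul_assoc]
        rw [sum_comm (s := univ)]
        exact sum_congr rfl fun U _ => sum_comm
    _ ≤ _ := by
        refine mul_le_mul_of_nonneg_left (sum_le_sum fun Q _ => ?_) (by positivity)
        exact mul_le_mul_of_nonneg_left (sum_weight_mul_abs_le_expect F Q (fcoeff f))
          (by positivity)
end
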